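/- arXiv:1605.09244 — 2 statements merged into one kernel-verified Lean document; each statement's English description precedes it below -/
import Mathlib

section
/- Let a, b, c, d, x, y be points of the Euclidean plane ℝ², pairwise distinct, such that: (greedy-path conditions) dist b d < dist a d, dist c d < dist b d, dist a c < dist a d, dist a b < dist a c, and dist b c < dist a c; (ray-divergence condition) b lies strictly between a and x, c lies strictly between d and x, and b, c, x are not collinear; (angle-additivity/convex-position conditions) ∠ a b c = ∠ a b d + ∠ d b c and ∠ d c b = ∠ d c a + ∠ a c b; (narrowness conditions) ∠ b x c < π/15, ∠ x b y < π/15, and ∠ x c y < π/15. Then dist a b < (1/2) · dist b y. -/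
open EuclideanGeometry Real

theorem cos_pi_div_fifteen_gt : (0.978 : ℝ) < cos (π / 15) := by
  have h := one_sub_sq_div_two_le_cos (x := π / 15)
  have := pi_lt_d4
  have := pi_pos
  nlinarith

theorem cos_two_pi_div_fifteen_gt : (0.9129 : ℝ) < cos (2 * (π / 15)) := by
  rw [cos_two_mul]
  nlinarith [cos_pi_div_fifteen_gt]

/-- A vector within angle `φ` of a unit vector `e` has a component of at least `cos φ * ‖w‖`
along `e`. -/
theorem cos_mul_norm_le_inner_of_angle_le {V : Type*} [NormedAddCommGroup V]
    [InnerProductSpace ℝ V] {e w : V} (he : ‖e‖ = 1) {φ : ℝ} (hφ : φ ≤ π)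
    (h : InnerProductGeometry.angle e w ≤ φ) : cos φ * ‖w‖ ≤ inner ℝ e w := by
  have h1 := InnerProductGeometry.cos_angle_mul_norm_mul_norm e w
  rw [he, one_mul] at h1
  rw [← h1]
  exact mul_le_mul_of_nonneg_right
    (cos_le_cos_of_nonneg_of_le_pi (InnerProductGeometry.angle_nonneg e w) hφ h) (norm_nonneg w)

/-- The component of `w` orthogonal to `e` in the plane. -/
def crossProd (e w : EuclideanSpace ℝ (Fin 2)) : ℝ := e 0 * w 1 - e 1 * w 0

theorem inner_sq_add_crossProd_sq {e : EuclideanSpace ℝ (Fin 2)} (he : ‖e‖ = 1)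
    (w : EuclideanSpace ℝ (Fin 2)) : inner ℝ e w ^ 2 + crossProd e w ^ 2 = ‖w‖ ^ 2 := by
  have h : ‖e‖ ^ 2 = 1 := by rw [he]; norm_num
  rw [EuclideanSpace.real_norm_sq_eq, Fin.sum_univ_two] at h ⊢
  simp only [PiLp.inner_apply, Fin.sum_univ_two, crossProd, RCLike.inner_apply, conj_trivial]
  linear_combination (w 0 ^ 2 + w 1 ^ 2) * h

/-- The inequality in coordinates centred at `b` with first axis along the ray from `a` to `b`:
`a = (-t, 0)`, `c = (c₁, c₂)`, `x = (c₁ + m, 0)`, `d = c + δ (c - x)` and `y = (y₁, y₂)`. -/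
theorem lt_half_of_coordinates {t m c₁ c₂ δ y₁ y₂ r : ℝ} (ht : 0 < t) (hm : 0 < m)
    (hc₂ : 0 ≤ c₂) (hcm : c₂ ≤ 0.2134 * m)
    (hbd : 0 < 2 * (c₁ - δ * m) + t)
    (hac : 2 * (m * (c₁ + t) - c₂ ^ 2) < δ * (m ^ 2 + c₂ ^ 2))
    (hbc : 0 < 2 * c₁ + t)
    (hyc : c₂ - y₂ ≤ 0.4472 * (y₁ - c₁)) (hy₁ : y₁ ≤ r) (hy₂ : y₂ ≤ 0.2134 * y₁) :
    t < 1 / 2 * r := by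
  obtain ⟨τ, rfl⟩ : ∃ τ, c₂ = τ * m := ⟨c₂ / m, by field_simp⟩
  have hτ : τ ≤ 0.2134 := le_of_mul_le_mul_right hcm hm
  have hτ0 : 0 ≤ τ := nonneg_of_mul_nonneg_left hc₂ hm
  have h2 : 2 * (c₁ + t - τ * (τ * m)) < δ * m * (1 + τ ^ 2) := by
    refine lt_of_mul_lt_mul_right ?_ hm.le
    linarith
  have h3 : δ * m * (1 + τ ^ 2) < (c₁ + t / 2) * (1 + τ ^ 2) := by
    apply mul_lt_mul_of_pos_right _ (by positivity)
    linarith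
  have h4 : 0 < (2 * c₁ + t) * (1 - τ ^ 2) := mul_pos hbc (by nlinarith)
  have h5 : t < 2 * (τ * (τ * m)) := by linarith
  have h6 : τ * (τ * m) ≤ 0.2134 * (τ * m) := mul_le_mul_of_nonneg_right hτ hc₂
  linarith

theorem crossProd_add (e v w : EuclideanSpace ℝ (Fin 2)) :
    crossProd e (v + w) = crossProd e v + crossProd e w := by
  simp only [crossProd, PiLp.add_apply]; ring

theorem crossProd_sub (e v w : EuclideanSpace ℝ (Fin 2)) :
    crossProd e (v - w) = crossProd e v - crossProd e w := by
  simp only [crossProd, PiLp.sub_apply]; ring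

theorem crossProd_smul (e w : EuclideanSpace ℝ (Fin 2)) (r : ℝ) :
    crossProd e (r • w) = r * crossProd e w := by
  simp only [crossProd, PiLp.smul_apply, smul_eq_mul]; ring

theorem crossProd_self (e : EuclideanSpace ℝ (Fin 2)) : crossProd e e = 0 := by
  simp only [crossProd]; ring

theorem abs_le_mul_of_sq_add_sq {u v w k l : ℝ} (hw : 0 ≤ w) (h : u ^ 2 + v ^ 2 = w ^ 2)
    (hk : 0 ≤ k) (hu : k * w ≤ u) (hl : 0 ≤ l) (hkl : 1 ≤ k ^ 2 * (1 + l ^ 2)) :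
    |v| ≤ l * u := by
  have hu0 : 0 ≤ u := (mul_nonneg hk hw).trans hu
  apply abs_le_of_sq_le_sq _ (mul_nonneg hl hu0)
  have h1 : (k * w) ^ 2 ≤ u ^ 2 := pow_le_pow_left₀ (mul_nonneg hk hw) hu 2
  nlinarith [mul_le_mul_of_nonneg_right hkl (sq_nonneg w),
    mul_le_mul_of_nonneg_right h1 (by positivity : 0 ≤ 1 + l ^ 2)]

theorem lemma2_full (a b c d x y : EuclideanSpace ℝ (Fin 2))
    (hdistinct : [a, b, c, d, x, y].Pairwise (· ≠ ·))
    (h1 : dist b d < dist a d) (h2 : dist c d < dist b d)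
    (h3 : dist a c < dist a d) (h4 : dist a b < dist a c)
    (h5 : dist b c < dist a c)
    (hbx : Sbtw ℝ a b x) (hcx : Sbtw ℝ d c x)
    (hncol : ¬ Collinear ℝ ({b, c, x} : Set (EuclideanSpace ℝ (Fin 2))))
    (hadd1 : ∠ a b c = ∠ a b d + ∠ d b c)
    (hadd2 : ∠ d c b = ∠ d c a + ∠ a c b)
    (hx : ∠ b x c < π / 15)
    (hby : ∠ x b y < π / 15) (hcy : ∠ x c y < π / 15) :
    dist a b < (1 / 2) * dist b y := by
  have hpi := pi_pos
  have hk := cos_pi_div_fifteen_gt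
  have hk2 := cos_two_pi_div_fifteen_gt
  have hxc : c ≠ x := hcx.ne_right
  have hax : 0 < ‖x - a‖ := norm_pos_iff.2 (sub_ne_zero.2 hbx.left_ne_right.symm)
  obtain ⟨s, ⟨hs0, hs1⟩, rfl⟩ := (sbtw_iff_mem_image_Ioo_and_ne.1 hbx).1
  obtain ⟨s', ⟨hs0', hs1'⟩, hc⟩ := (sbtw_iff_mem_image_Ioo_and_ne.1 hcx).1
  set b := AffineMap.lineMap a x s with hb
  set A := ‖x - a‖ with hA
  set e := A⁻¹ • (x - a) with he
  have he1 : ‖e‖ = 1 := by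
    rw [he, norm_smul, norm_inv, Real.norm_of_nonneg hax.le, ← hA, inv_mul_cancel₀ hax.ne']
  have hAe : x - a = A • e := by rw [he, smul_inv_smul₀ hax.ne']
  have hab : a = b - (s * A) • e := by
    rw [mul_smul, ← hAe, hb, AffineMap.lineMap_apply_module']; abel
  have hxb : x - b = ((1 - s) * A) • e := by
    rw [mul_smul, ← hAe, hb, AffineMap.lineMap_apply_module']; module
  clear_value e b
  have ht : 0 < s * A := mul_pos hs0 hax
  have hp : 0 < (1 - s) * A := mul_pos (by linarith) hax
  generalize s * A = t at *
  generalize (1 - s) * A = p at *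
  obtain ⟨δ, hδ, hd⟩ : ∃ δ : ℝ, 0 < δ ∧ d = c - δ • (x - c) := by
    refine ⟨s' / (1 - s'), div_pos hs0' (by linarith), ?_⟩
    have h : x - c = (1 - s') • (x - d) := by
      rw [← hc, AffineMap.lineMap_apply_module']; module
    have h' : (1 - s') ≠ 0 := by linarith
    rw [h, smul_smul, div_mul_cancel₀ _ h', ← hc, AffineMap.lineMap_apply_module']; abel
  have hdab : dist a b = t := by
    rw [dist_eq_norm, hab, sub_sub_cancel_left, norm_neg, norm_smul, he1, mul_one,
      Real.norm_of_nonneg ht.le]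
  have hθ : InnerProductGeometry.angle e (x - c) < π / 15 := by
    rw [EuclideanGeometry.angle, vsub_eq_sub, vsub_eq_sub, ← neg_sub x b, ← neg_sub x c,
      InnerProductGeometry.angle_neg_neg, hxb, InnerProductGeometry.angle_smul_left_of_pos _ _ hp]
      at hx
    exact hx
  have hη : InnerProductGeometry.angle e (y - b) < π / 15 := by
    rw [EuclideanGeometry.angle, vsub_eq_sub, vsub_eq_sub, hxb,
      InnerProductGeometry.angle_smul_left_of_pos _ _ hp] at hby
    exact hby
  have hζ : InnerProductGeometry.angle e (y - c) ≤ 2 * (π / 15) := by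
    have := InnerProductGeometry.angle_le_angle_add_angle e (x - c) (y - c)
    rw [EuclideanGeometry.angle, vsub_eq_sub, vsub_eq_sub] at hcy
    linarith
  have hm := cos_mul_norm_le_inner_of_angle_le he1 (by linarith) hθ.le
  have hyb := cos_mul_norm_le_inner_of_angle_le he1 (by linarith) hη.le
  have hyc := cos_mul_norm_le_inner_of_angle_le he1 (by linarith) hζ
  have hxc0 : 0 < ‖x - c‖ := norm_pos_iff.2 (sub_ne_zero.2 hxc.symm)
  have hpyth := inner_sq_add_crossProd_sq he1
  have hm0 : 0 < inner ℝ e (x - c) := lt_of_lt_of_le (mul_pos (by linarith) hxc0) hm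
  have hcm := abs_le_mul_of_sq_add_sq (norm_nonneg _) (hpyth (x - c)) (by norm_num)
    ((mul_le_mul_of_nonneg_right hk.le (norm_nonneg _)).trans hm)
    (by norm_num : (0 : ℝ) ≤ 0.2134) (by norm_num)
  have hyc' := abs_le_mul_of_sq_add_sq (norm_nonneg _) (hpyth (y - c)) (by norm_num)
    ((mul_le_mul_of_nonneg_right hk2.le (norm_nonneg _)).trans hyc)
    (by norm_num : (0 : ℝ) ≤ 0.4472) (by norm_num)
  have hyb' := abs_le_mul_of_sq_add_sq (norm_nonneg _) (hpyth (y - b)) (by norm_num)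
    ((mul_le_mul_of_nonneg_right hk.le (norm_nonneg _)).trans hyb)
    (by norm_num : (0 : ℝ) ≤ 0.2134) (by norm_num)
  have hyr : inner ℝ e (y - b) ≤ dist b y := by
    rw [dist_comm, dist_eq_norm]
    simpa [he1] using real_inner_le_norm e (y - b)
  have hee : inner ℝ e e = (1 : ℝ) := by rw [real_inner_self_eq_norm_sq, he1]; norm_num
  have hQxc : crossProd e (x - c) = -crossProd e (c - b) := by
    rw [← sub_sub_sub_cancel_right x c b, hxb, crossProd_sub, crossProd_smul, crossProd_self]
    ring
  have hPyc : inner ℝ e (y - c) = inner ℝ e (y - b) - inner ℝ e (c - b) := by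
    rw [← inner_sub_right, sub_sub_sub_cancel_right]
  have hQyc : crossProd e (y - c) = crossProd e (y - b) - crossProd e (c - b) := by
    rw [← crossProd_sub, sub_sub_sub_cancel_right]
  have hcb : dist b c ^ 2 = inner ℝ e (c - b) ^ 2 + crossProd e (c - b) ^ 2 := by
    rw [hpyth, dist_comm, dist_eq_norm]
  have hca : dist a c ^ 2 = (inner ℝ e (c - b) + t) ^ 2 + crossProd e (c - b) ^ 2 := by
    have h : c - a = (c - b) + t • e := by rw [hab]; abel
    rw [dist_comm, dist_eq_norm, ← hpyth, h, inner_add_right, crossProd_add, real_inner_smul_right,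
      crossProd_smul, crossProd_self, hee]
    ring
  have hdb : dist b d ^ 2 = (inner ℝ e (c - b) - δ * inner ℝ e (x - c)) ^ 2
      + ((1 + δ) * crossProd e (c - b)) ^ 2 := by
    have h : d - b = (c - b) - δ • (x - c) := by rw [hd]; abel
    rw [dist_comm, dist_eq_norm, ← hpyth, h, inner_sub_right, crossProd_sub, real_inner_smul_right,
      crossProd_smul, hQxc]
    ring
  have hda : dist a d ^ 2 = (inner ℝ e (c - b) - δ * inner ℝ e (x - c) + t) ^ 2
      + ((1 + δ) * crossProd e (c - b)) ^ 2 := by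
    have h : d - a = (c - b) - δ • (x - c) + t • e := by rw [hd, hab]; abel
    rw [dist_comm, dist_eq_norm, ← hpyth, h, inner_add_right, crossProd_add, inner_sub_right,
      crossProd_sub, real_inner_smul_right, real_inner_smul_right,
      crossProd_smul, crossProd_smul, crossProd_self, hee, hQxc]
    ring
  have hbd := pow_lt_pow_left₀ h1 dist_nonneg two_ne_zero
  have hac := pow_lt_pow_left₀ h3 dist_nonneg two_ne_zero
  have hbc := pow_lt_pow_left₀ h5 dist_nonneg two_ne_zero
  rw [hdb, hda] at hbd
  rw [hca, hda] at hac
  rw [hcb, hca] at hbc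
  rw [hQxc, abs_neg] at hcm
  rw [hQyc, hPyc] at hyc'
  rw [hdab]
  generalize inner ℝ e (x - c) = m at *
  generalize inner ℝ e (c - b) = c₁ at *
  generalize crossProd e (c - b) = c₂ at *
  generalize inner ℝ e (y - b) = y₁ at *
  generalize crossProd e (y - b) = y₂ at *
  have hbd' : 0 < 2 * (c₁ - δ * m) + t :=
    pos_of_mul_pos_right (a := t) (by linarith) ht.le
  have hbc' : 0 < 2 * c₁ + t := pos_of_mul_pos_right (a := t) (by linarith) ht.le
  have hac' : 2 * (m * (c₁ + t) - c₂ ^ 2) < δ * (m ^ 2 + c₂ ^ 2) :=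
    lt_of_mul_lt_mul_left (a := δ) (by linarith) hδ.le
  rw [abs_le] at hyc' hyb' hcm
  rcases le_total 0 c₂ with hc₂ | hc₂
  · exact lt_half_of_coordinates ht hm0 hc₂ hcm.2 hbd' hac' hbc' (by linarith) hyr hyb'.2
  · exact lt_half_of_coordinates (c₂ := -c₂) (y₂ := -y₂) ht hm0 (by linarith) (by linarith) hbd'
      (by rwa [neg_sq]) hbc' (by linarith) hyr (by linarith)
end

section
/- Let a, b, c be points of the Euclidean plane ℝ² with 4π/15 < ∠ b a c < π/2 and ∠ a c b < 2π/5. Then dist a b < 1.28 · dist b c. -/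
open EuclideanGeometry Real

/-- The sines of `72°` and `48°` have ratio less than `1.28`. -/
lemma sin_two_pi_div_five_lt_mul_sin_four_pi_div_fifteen :
    sin (2 * π / 5) < 1.28 * sin (4 * π / 15) := by
  have hC := quadratic_root_cos_pi_div_five
  have hC0 : 0 < cos (π / 5) := cos_pos_of_mem_Ioo ⟨by linarith [pi_pos], by linarith [pi_pos]⟩
  have hS0 : 0 < sin (π / 5) := sin_pos_of_pos_of_lt_pi (by positivity) (by linarith [pi_pos])
  have hT0 : 0 < sin (4 * π / 15) :=
    sin_pos_of_pos_of_lt_pi (by positivity) (by linarith [pi_pos])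
  have hSC := sin_sq_add_cos_sq (π / 5)
  have h72 : sin (2 * π / 5) = 2 * sin (π / 5) * cos (π / 5) := by
    rw [← sin_two_mul]; ring_nf
  have h96 : 2 * sin (4 * π / 15) ^ 2 =
      1 - (cos (π / 5) / 2 - √3 / 2 * sin (π / 5)) := by
    have h : 2 * (4 * π / 15) = π / 3 + π / 5 := by ring
    have h' := cos_two_mul (4 * π / 15)
    rw [h, cos_add, cos_pi_div_three, sin_pi_div_three] at h'
    linarith [sin_sq_add_cos_sq (4 * π / 15)]
  rw [h72]
  generalize cos (π / 5) = C at *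
  generalize sin (π / 5) = S at *
  generalize sin (4 * π / 15) = T at *
  have h3 : 1.73205 < √3 := lt_sqrt_of_sq_lt (by norm_num)
  have hCl : 0.80901 < C := by nlinarith
  have hCu : C < 0.80902 := by nlinarith
  have hSl : 0.58777 < S := by nlinarith
  have h3S : 1.73205 * 0.58777 < √3 * S := by gcongr
  refine lt_of_pow_lt_pow_left₀ 2 (by positivity) ?_
  have hSq : (2 * S * C) ^ 2 = (2 * C + 1) * (1 - C ^ 2) := by
    linear_combination 4 * C ^ 2 * hSC + (1 - C ^ 2) * hC
  rw [hSq, mul_pow]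
  nlinarith

theorem spine_edge_estimate (a b c : EuclideanSpace ℝ (Fin 2))
    (hlo : 4 * π / 15 < ∠ b a c) (hhi : ∠ b a c < π / 2)
    (hc : ∠ a c b < 2 * π / 5) :
    dist a b < 1.28 * dist b c := by
  have hbc : b ≠ c := by
    rintro rfl
    rcases eq_or_ne b a with rfl | hba
    · rw [angle_self_left] at hhi
      exact lt_irrefl _ hhi
    · rw [angle_self_of_ne hba] at hlo
      linarith [pi_pos]
  have hpos : 0 < dist b c := dist_pos.2 hbc
  have hlaw := law_sin a c b
  rw [dist_comm c b, dist_comm b a] at hlaw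
  have hA : sin (4 * π / 15) < sin (∠ b a c) :=
    sin_lt_sin_of_lt_of_le_pi_div_two (by linarith [pi_pos]) hhi.le hlo
  have hB : sin (∠ a c b) < sin (2 * π / 5) :=
    sin_lt_sin_of_lt_of_le_pi_div_two (by linarith [pi_pos, angle_nonneg a c b])
      (by linarith [pi_pos]) hc
  have hT0 : 0 < sin (4 * π / 15) :=
    sin_pos_of_pos_of_lt_pi (by positivity) (by linarith [pi_pos])
  have hlt : sin (∠ a c b) < 1.28 * sin (∠ b a c) := by
    linarith [sin_two_pi_div_five_lt_mul_sin_four_pi_div_fifteen]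
  refine lt_of_mul_lt_mul_left ?_ (hT0.trans hA).le
  calc sin (∠ b a c) * dist a b = sin (∠ a c b) * dist b c := hlaw.symm
    _ < 1.28 * sin (∠ b a c) * dist b c := by gcongr
    _ = sin (∠ b a c) * (1.28 * dist b c) := by ring
end
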